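/- Let K be a field, R = K⟦t⟧, and let C be a chain complex of finitely generated free R-modules indexed by ℕ which is isomorphic, as a complex of R-modules, to (⊕_i F(i)^{⊕ b_i}) ⊕ (⊕_i ⊕_{j=1}^{c_i} E(i, a_{i,j})) with b_i, c_i ∈ ℕ and all a_{i,j} ≥ 1. For m ≥ n in ℕ let ψ_{n,m} : C ⊗_R R/(t^{n+1}) → C ⊗_R R/(t^{m+1}) be the map of complexes induced degreewise by the R-module homomorphism R/(t^{n+1}) → R/(t^{m+1}), x ↦ t^{m−n}·x. Fix i ∈ ℕ and suppose a_{i,j} ≤ n+1 and a_{i,j} ≤ m−n for all 1 ≤ j ≤ c_i, and (if i ≥ 1) a_{i−1,j} ≤ n+1 for all 1 ≤ j ≤ c_{i−1}. Then the kernel of H_i(ψ_{n,m}) is isomorphic to ⊕_{j=1}^{c_i} R/(t^{a_{i,j}}), of dimension Σ_{j=1}^{c_i} a_{i,j} over K, and the cokernel of H_i(ψ_{n,m}) is isomorphic to (R/(t^{m−n}))^{b_i} ⊕ ⊕_{j=1}^{c_i} R/(t^{a_{i,j}}), of dimension (m−n)·b_i + Σ_{j=1}^{c_i} a_{i,j}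 over K. -/

import Mathlib

/-!
Preliminaries for statements about complexes of finitely generated free modules over
`R = K⟦t⟧`: ℕ-indexed chain complexes, the elementary complexes `F(i)` and `E(i,a)`,
their direct sums, homology, and tensoring with `R/(t^{n+1})`.
-/

universe u

noncomputable section

namespace TorsionComplex

variable {R : Type u} [CommRing R]

/-- A chain complex of `R`-modules indexed by `ℕ` (homological indexing):
modules `X i` and differentials `d i : X (i+1) → X i` with `d ∘ d = 0`. -/
structure NatComplex (R : Type u) [CommRing R] : Type (u + 1) where
  X : ℕ → Type u
  [acg : ∀ i, AddCommGroup (X i)]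
  [mod : ∀ i, Module R (X i)]
  d : ∀ i, X (i + 1) →ₗ[R] X i
  dd : ∀ i, (d i).comp (d (i + 1)) = 0

attribute [instance] NatComplex.acg NatComplex.mod

/-- An isomorphism of ℕ-indexed chain complexes of `R`-modules. -/
structure ComplexIso (C D : NatComplex R) where
  e : ∀ i, C.X i ≃ₗ[R] D.X i
  comm : ∀ i x, e i (C.d i x) = D.d i (e (i + 1) x)

/-- A morphism of ℕ-indexed chain complexes of `R`-modules. -/
structure ComplexHom (C D : NatComplex R) where
  f : ∀ i, C.X i →ₗ[R] D.X i
  comm : ∀ i x, f i (C.d i x) = D.d i (f (i + 1) x)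

/-- The cycles in degree `i`: all of `X 0` in degree `0`, and the kernel of the
outgoing differential `X (i+1) → X i` in degree `i+1`. -/
def cycles (C : NatComplex R) : ∀ i, Submodule R (C.X i)
  | 0 => ⊤
  | (i + 1) => LinearMap.ker (C.d i)

/-- The boundaries in degree `i`: the range of `d i : X (i+1) → X i`. -/
def boundaries (C : NatComplex R) (i : ℕ) : Submodule R (C.X i) :=
  LinearMap.range (C.d i)

/-- The `i`-th homology of an ℕ-indexed chain complex: cycles modulo boundaries. -/
abbrev homology (C : NatComplex R) (i : ℕ) : Type u :=
  (cycles C i) ⧸ (Submodule.comap (cycles C i).subtype (boundaries C i))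

theorem mapsTo_cycles {C D : NatComplex R} (φ : ComplexHom C D) (i : ℕ) :
    ∀ x ∈ cycles C i, φ.f i x ∈ cycles D i := by
  intro x hx
  cases i with
  | zero => trivial
  | succ i =>
    simp only [cycles, LinearMap.mem_ker] at hx ⊢
    rw [← φ.comm i, hx, map_zero]

/-- The map on homology induced by a morphism of complexes. -/
def ComplexHom.homologyMap {C D : NatComplex R} (φ : ComplexHom C D) (i : ℕ) :
    homology C i →ₗ[R] homology D i :=
  Submodule.mapQ _ _ ((φ.f i).restrict (mapsTo_cycles φ i))
    (by
      rintro ⟨x, hx⟩ hmem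
      simp only [Submodule.mem_comap, boundaries] at hmem ⊢
      obtain ⟨y, hy⟩ := hmem
      exact ⟨φ.f (i + 1) y, by simp [LinearMap.restrict_apply, ← φ.comm i, hy]⟩)

end TorsionComplex

end

noncomputable section

namespace TorsionComplex

/-- `prevNat c` is the shift of `c`: `prevNat c 0 = 0`, `prevNat c (i+1) = c i`
(used to encode quantities indexed by `i − 1`, with the convention `c_{−1} = 0`). -/
def prevNat (c : ℕ → ℕ) : ℕ → ℕ
  | 0 => 0
  | (i + 1) => c i

/-- `prevA a` shifts a doubly-indexed family: `prevA a (i+1) = a i` (and the empty family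
in degree `0`). -/
def prevA {c : ℕ → ℕ} (a : ∀ i, Fin (c i) → ℕ) : ∀ i, Fin (prevNat c i) → ℕ
  | 0 => Fin.elim0
  | (i + 1) => a i

variable (K : Type u) [Field K]

/-- Degree-`i` term of the direct sum `(⊕_j F(j)^{b_j}) ⊕ (⊕_j ⊕_{l<c_j} E(j, a_{j,l}))`:
`F(j)` contributes a copy of `R` in degree `j`, and `E(j,a)` contributes a copy of `R` in
degrees `j+1` and `j`. -/
abbrev stdX (b c : ℕ → ℕ) (i : ℕ) : Type u :=
  (Fin (b i) → PowerSeries K) × (Fin (c i) → PowerSeries K) ×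
    (Fin (prevNat c i) → PowerSeries K)

/-- Differential of the standard complex: on the summand `E(i, a_{i,j})` it is
multiplication by `t^{a_{i,j}}` from degree `i+1` to degree `i`; it vanishes on the
summands `F(i)`. -/
def stdD (b c : ℕ → ℕ) (a : ∀ i, Fin (c i) → ℕ) (i : ℕ) :
    stdX K b c (i + 1) →ₗ[PowerSeries K] stdX K b c i :=
  LinearMap.prod 0 (LinearMap.prod
    ((LinearMap.pi fun j : Fin (c i) =>
        (PowerSeries.X : PowerSeries K) ^ (a i j) • LinearMap.proj j).comp
      ((LinearMap.snd _ _ _).comp (LinearMap.snd _ _ _)))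
    0)

/-- The direct sum, with finitely many summands in each degree, of the elementary
complexes `F(i)` (a copy of `R` in degree `i`), with multiplicity `b i`, and
`E(i, a i j)` (copies of `R` in degrees `i+1` and `i`, with differential multiplication
by `t^{a i j}`), for `j : Fin (c i)`. -/
def stdComplex (b c : ℕ → ℕ) (a : ∀ i, Fin (c i) → ℕ) : NatComplex (PowerSeries K) where
  X := stdX K b c
  d := stdD K b c a
  dd i := by
    apply LinearMap.ext
    intro x
    simp [stdD, LinearMap.prod_apply]

end TorsionComplex

end

noncomputable section

namespace TorsionComplex

variable (K : Type u) [Field K]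

/-- The quotient module `R/(t^m)`, `R = K⟦t⟧`. -/
abbrev qmod (m : ℕ) : Type u :=
  PowerSeries K ⧸ Ideal.span {(PowerSeries.X : PowerSeries K) ^ m}

/-- The complex `C ⊗_R R/(t^m)`, obtained by applying `− ⊗_R R/(t^m)` degreewise. -/
def tensorQ (C : NatComplex (PowerSeries K)) (m : ℕ) : NatComplex (PowerSeries K) where
  X i := TensorProduct (PowerSeries K) (C.X i) (qmod K m)
  d i := LinearMap.rTensor _ (C.d i)
  dd i := by
    rw [← LinearMap.rTensor_comp, C.dd, LinearMap.rTensor_zero]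

/-- The `R`-linear map `R/(t^{n+1}) → R/(t^{m+1})`, `x ↦ t^{m−n}·x`. -/
def qmodShift (n m : ℕ) (hnm : n ≤ m) : qmod K (n + 1) →ₗ[PowerSeries K] qmod K (m + 1) :=
  Submodule.liftQ _
    ((PowerSeries.X : PowerSeries K) ^ (m - n) •
      (Ideal.span {(PowerSeries.X : PowerSeries K) ^ (m + 1)}).mkQ)
    (by
      rw [Ideal.span_le, Set.singleton_subset_iff]
      have : ((PowerSeries.X : PowerSeries K) ^ (m - n) •
            (Ideal.span {(PowerSeries.X : PowerSeries K) ^ (m + 1)}).mkQ)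
            ((PowerSeries.X : PowerSeries K) ^ (n + 1))
          = Submodule.Quotient.mk ((PowerSeries.X : PowerSeries K) ^ (m + 1)) := by
        rw [LinearMap.smul_apply, Submodule.mkQ_apply, ← Submodule.Quotient.mk_smul,
          smul_eq_mul, ← pow_add]
        congr 2
        omega
      simp only [SetLike.mem_coe, LinearMap.mem_ker, this, Submodule.Quotient.mk_eq_zero]
      exact Ideal.subset_span rfl)

end TorsionComplex

end

noncomputable section

namespace TorsionComplex

variable (K : Type u) [Field K]

/-- The map of complexes `ψ_{n,m} : C ⊗_R R/(t^{n+1}) → C ⊗_R R/(t^{m+1})` induced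
degreewise by `R/(t^{n+1}) → R/(t^{m+1})`, `x ↦ t^{m−n}·x`. -/
def tensorShift (C : NatComplex (PowerSeries K)) (n m : ℕ) (hnm : n ≤ m) :
    ComplexHom (tensorQ K C (n + 1)) (tensorQ K C (m + 1)) where
  f i := LinearMap.lTensor (C.X i) (qmodShift K n m hnm)
  comm i x := by
    show (LinearMap.lTensor (C.X i) (qmodShift K n m hnm)).comp
        (LinearMap.rTensor (qmod K (n+1)) (C.d i)) x
      = ((LinearMap.rTensor (qmod K (m+1)) (C.d i)).comp
        (LinearMap.lTensor (C.X (i+1)) (qmodShift K n m hnm))) x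
    rw [LinearMap.lTensor_comp_rTensor, LinearMap.rTensor_comp_lTensor]

end TorsionComplex

end

open TorsionComplex


noncomputable section
namespace TorsionComplex
open TensorProduct

section
variable (K : Type u) [Field K]

def qcoeff (N : ℕ) : PowerSeries K →ₗ[K] (Fin N → K) :=
  LinearMap.pi fun j => PowerSeries.coeff (R := K) j.1

theorem finrank_qmod (N : ℕ) : Module.finrank K (qmod K N) = N ∧ Module.Finite K (qmod K N) := by
  have hs : Function.Surjective (qcoeff K N) := by
    intro v
    refine ⟨PowerSeries.mk fun k => if h : k < N then v ⟨k, h⟩ else 0, ?_⟩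
    ext j
    simp [qcoeff]
  have hk : LinearMap.ker (qcoeff K N) =
      (Ideal.span {(PowerSeries.X : PowerSeries K) ^ N}).restrictScalars K := by
    ext x
    simp only [LinearMap.mem_ker, Submodule.restrictScalars_mem, Ideal.mem_span_singleton,
      PowerSeries.X_pow_dvd_iff, qcoeff, funext_iff, Fin.forall_iff]
    rfl
  have e1 : (PowerSeries K ⧸ (Ideal.span {(PowerSeries.X : PowerSeries K) ^ N}).restrictScalars K)
      ≃ₗ[K] (Fin N → K) :=
    (Submodule.quotEquivOfEq _ _ hk.symm).trans ((qcoeff K N).quotKerEquivOfSurjective hs)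
  have e2 : qmod K N ≃ₗ[K] (Fin N → K) :=
    (Submodule.Quotient.restrictScalarsEquiv K _).symm.trans e1
  exact ⟨by rw [e2.finrank_eq]; simp, Module.Finite.equiv e2.symm⟩

instance (N : ℕ) : Module.Finite K (qmod K N) := (finrank_qmod K N).2

theorem finrank_of_equiv {M P : Type u} [AddCommGroup M] [Module (PowerSeries K) M]
    [AddCommGroup P] [Module (PowerSeries K) P] [Module K P] [IsScalarTower K (PowerSeries K) P]
    (e : M ≃ₗ[PowerSeries K] P) :
    Module.finrank K (RestrictScalars K (PowerSeries K) M) = Module.finrank K P := by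
  let e' : RestrictScalars K (PowerSeries K) M ≃ₗ[K] P :=
    { ((RestrictScalars.addEquiv K (PowerSeries K) M).trans e.toAddEquiv) with
      map_smul' := by
        intro k x
        change e ((RestrictScalars.addEquiv K (PowerSeries K) M) (k • x)) = k • e _
        rw [RestrictScalars.addEquiv_map_smul, map_smul, algebraMap_smul]
        rfl }
  exact e'.finrank_eq

/-! the model -/
abbrev mX (b c : ℕ → ℕ) (N i : ℕ) : Type u :=
  (Fin (b i) → qmod K N) × (Fin (c i) → qmod K N) × (Fin (prevNat c i) → qmod K N)

def tpi (k N : ℕ) : ((Fin k → PowerSeries K) ⊗[PowerSeries K] qmod K N) ≃ₗ[PowerSeries K] (Fin k → qmod K N) :=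
  (TensorProduct.comm _ _ _).trans (TensorProduct.piScalarRight _ (PowerSeries K) _ _)

def tX (b c : ℕ → ℕ) (N i : ℕ) :
    (stdX K b c i ⊗[PowerSeries K] qmod K N) ≃ₗ[PowerSeries K] mX K b c N i :=
  (TensorProduct.prodLeft _ (PowerSeries K) _ _ _).trans
   ((tpi K _ N).prodCongr ((TensorProduct.prodLeft _ (PowerSeries K) _ _ _).trans
     ((tpi K _ N).prodCongr (tpi K _ N))))

theorem tpi_tmul (k N : ℕ) (v : Fin k → PowerSeries K) (q : qmod K N) :
    tpi K k N (v ⊗ₜ q) = fun j => v j • q := by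
  simp [tpi]

theorem tX_tmul (b c : ℕ → ℕ) (N i : ℕ) (v1 : Fin (b i) → PowerSeries K)
    (v2 : Fin (c i) → PowerSeries K) (v3 : Fin (prevNat c i) → PowerSeries K) (q : qmod K N) :
    tX K b c N i ((v1, v2, v3) ⊗ₜ q) =
      (fun j => v1 j • q, fun j => v2 j • q, fun j => v3 j • q) := by
  simp only [tX, LinearEquiv.trans_apply, TensorProduct.prodLeft_tmul,
    LinearEquiv.prodCongr_apply, tpi_tmul]

variable {K} {C : NatComplex (PowerSeries K)} {b c : ℕ → ℕ} {a : ∀ i, Fin (c i) → ℕ}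

def gX (e : ComplexIso C (stdComplex K b c a)) (N i : ℕ) :
    (tensorQ K C N).X i ≃ₗ[PowerSeries K] mX K b c N i :=
  (TensorProduct.congr (e.e i) (LinearEquiv.refl _ _)).trans (tX K b c N i)

def tq {N i : ℕ} (x : C.X i) (q : qmod K N) : (tensorQ K C N).X i := x ⊗ₜ[PowerSeries K] q

theorem tq_ext {N i : ℕ} {P : Type u} [AddCommGroup P] [Module (PowerSeries K) P]
    {f g : (tensorQ K C N).X i →ₗ[PowerSeries K] P}
    (h : ∀ x q, f (tq x q) = g (tq x q)) : f = g :=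
  TensorProduct.ext' h

def eX (e : ComplexIso C (stdComplex K b c a)) {i : ℕ} (x : C.X i) : stdX K b c i := e.e i x

theorem gX_tq (e : ComplexIso C (stdComplex K b c a)) (N i : ℕ) (x : C.X i) (q : qmod K N) :
    gX e N i (tq x q) = (fun j => (eX e x).1 j • q, fun j => (eX e x).2.1 j • q,
      fun j => (eX e x).2.2 j • q) :=
  tX_tmul K b c N i (eX e x).1 (eX e x).2.1 (eX e x).2.2 q

theorem eX_d (e : ComplexIso C (stdComplex K b c a)) (i : ℕ) (x : C.X (i+1)) :
    eX e (C.d i x) = (0, fun j => (PowerSeries.X : PowerSeries K) ^ a i j * (eX e x).2.2 j, 0) :=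
  e.comm i x

variable (a) in
def mD (b : ℕ → ℕ) (N i : ℕ) : mX K b c N (i+1) →ₗ[PowerSeries K] mX K b c N i where
  toFun x := (0, fun j => (PowerSeries.X : PowerSeries K) ^ a i j • x.2.2 j, 0)
  map_add' x y := by
    refine Prod.ext ?_ (Prod.ext ?_ ?_)
    · exact (add_zero _).symm
    · funext j; exact smul_add _ _ _
    · exact (add_zero _).symm
  map_smul' r x := by
    refine Prod.ext ?_ (Prod.ext ?_ ?_)
    · exact (smul_zero _).symm
    · funext j; exact smul_comm ((PowerSeries.X : PowerSeries K) ^ a i j) r (x.2.2 j)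
    · exact (smul_zero _).symm

def mS (b c : ℕ → ℕ) {n m : ℕ} (hnm : n ≤ m) (i : ℕ) :
    mX K b c (n+1) i →ₗ[PowerSeries K] mX K b c (m+1) i where
  toFun x := (fun j => qmodShift K n m hnm (x.1 j), fun j => qmodShift K n m hnm (x.2.1 j),
    fun j => qmodShift K n m hnm (x.2.2 j))
  map_add' x y := by
    refine Prod.ext ?_ (Prod.ext ?_ ?_) <;> funext j <;> exact map_add _ _ _
  map_smul' r x := by
    refine Prod.ext ?_ (Prod.ext ?_ ?_) <;> funext j <;> exact map_smul (qmodShift K n m hnm) r _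

theorem gX_d (e : ComplexIso C (stdComplex K b c a)) (N i : ℕ) (x : (tensorQ K C N).X (i+1)) :
    gX e N i ((tensorQ K C N).d i x) =
      (0, fun j => (PowerSeries.X : PowerSeries K) ^ a i j • (gX e N (i+1) x).2.2 j, 0) := by
  have : (gX e N i).toLinearMap ∘ₗ (tensorQ K C N).d i =
      mD a b N i ∘ₗ (gX e N (i+1)).toLinearMap := by
    refine tq_ext fun x q => ?_
    change gX e N i (tq (C.d i x) q) = mD a b N i (gX e N (i+1) (tq x q))
    rw [gX_tq, gX_tq, eX_d]
    refine Prod.ext ?_ (Prod.ext ?_ ?_)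
    · funext j; exact zero_smul _ _
    · funext j; exact mul_smul _ _ _
    · funext j; exact zero_smul _ _
  exact LinearMap.congr_fun this x

theorem gX_shift (e : ComplexIso C (stdComplex K b c a)) (n m : ℕ) (hnm : n ≤ m) (i : ℕ)
    (x : (tensorQ K C (n+1)).X i) :
    gX e (m+1) i ((tensorShift K C n m hnm).f i x) =
      (fun j => qmodShift K n m hnm ((gX e (n+1) i x).1 j),
       fun j => qmodShift K n m hnm ((gX e (n+1) i x).2.1 j),
       fun j => qmodShift K n m hnm ((gX e (n+1) i x).2.2 j)) := by
  have : (gX e (m+1) i).toLinearMap ∘ₗ (tensorShift K C n m hnm).f i =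
      mS b c hnm i ∘ₗ (gX e (n+1) i).toLinearMap := by
    refine tq_ext fun x q => ?_
    change gX e (m+1) i (tq x (qmodShift K n m hnm q)) = mS b c hnm i (gX e (n+1) i (tq x q))
    rw [gX_tq, gX_tq]
    refine Prod.ext ?_ (Prod.ext ?_ ?_) <;> funext j <;> exact (map_smul _ _ _).symm
  exact LinearMap.congr_fun this x

theorem mem_boundaries (e : ComplexIso C (stdComplex K b c a)) (N i : ℕ) (x : (tensorQ K C N).X i) :
    x ∈ boundaries (tensorQ K C N) i ↔ (gX e N i x).1 = 0 ∧
      (∀ j, ∃ y, (gX e N i x).2.1 j = (PowerSeries.X : PowerSeries K) ^ a i j • y) ∧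
      (gX e N i x).2.2 = 0 := by
  constructor
  · rintro ⟨y, rfl⟩
    rw [gX_d]
    exact ⟨rfl, fun j => ⟨_, rfl⟩, rfl⟩
  · rintro ⟨h1, h2, h3⟩
    choose y hy using h2
    refine ⟨(gX e N (i+1)).symm (0, 0, y), (gX e N i).injective ?_⟩
    rw [gX_d, LinearEquiv.apply_symm_apply]
    exact Prod.ext h1.symm (Prod.ext (funext fun j => (hy j).symm) h3.symm)

theorem mem_cycles (e : ComplexIso C (stdComplex K b c a)) (N i : ℕ) (x : (tensorQ K C N).X i) :
    x ∈ cycles (tensorQ K C N) i ↔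
      ∀ j, (PowerSeries.X : PowerSeries K) ^ prevA a i j • (gX e N i x).2.2 j = 0 := by
  cases i with
  | zero => exact ⟨fun _ j => j.elim0, fun _ => trivial⟩
  | succ i =>
    change (tensorQ K C N).d i x = 0 ↔ _
    rw [← (gX e N i).map_eq_zero_iff, gX_d]
    constructor
    · intro h j
      exact congrFun (congrArg (fun z => z.2.1) h) j
    · intro h
      exact Prod.ext rfl (Prod.ext (funext h) rfl)

variable (K) in
/-- projection R/t^N → R/t^k for k ≤ N -/
def qproj (N k : ℕ) (h : k ≤ N) : qmod K N →ₗ[PowerSeries K] qmod K k :=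
  Submodule.mapQ _ _ LinearMap.id (by
    intro x hx
    rw [Ideal.mem_span_singleton] at hx
    exact Ideal.mem_span_singleton.2 ((pow_dvd_pow _ h).trans hx))

theorem qproj_surj (N k : ℕ) (h : k ≤ N) : Function.Surjective (qproj K N k h) := by
  intro y
  obtain ⟨y, rfl⟩ := Submodule.Quotient.mk_surjective _ y
  exact ⟨Submodule.Quotient.mk y, rfl⟩

theorem qproj_eq_zero (N k : ℕ) (h : k ≤ N) (x : qmod K N) :
    qproj K N k h x = 0 ↔ ∃ y, x = (PowerSeries.X : PowerSeries K) ^ k • y := by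
  constructor
  · obtain ⟨x, rfl⟩ := Submodule.Quotient.mk_surjective _ x
    intro hx
    obtain ⟨y, rfl⟩ := Ideal.mem_span_singleton.1 ((Submodule.Quotient.mk_eq_zero _).1 hx)
    exact ⟨Submodule.Quotient.mk y, rfl⟩
  · rintro ⟨y, rfl⟩
    obtain ⟨y, rfl⟩ := Submodule.Quotient.mk_surjective _ y
    exact (Submodule.Quotient.mk_eq_zero _).2 (Ideal.mem_span_singleton.2 ⟨y, rfl⟩)

theorem qmodShift_mk (n m : ℕ) (hnm : n ≤ m) (x : PowerSeries K) :
    qmodShift K n m hnm (Submodule.Quotient.mk x) =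
      Submodule.Quotient.mk ((PowerSeries.X : PowerSeries K) ^ (m - n) * x) := rfl

theorem qmodShift_inj (n m : ℕ) (hnm : n ≤ m) (x : qmod K (n+1))
    (hx : qmodShift K n m hnm x = 0) : x = 0 := by
  obtain ⟨x, rfl⟩ := Submodule.Quotient.mk_surjective _ x
  rw [qmodShift_mk, Submodule.Quotient.mk_eq_zero, Ideal.mem_span_singleton,
    show m + 1 = (m - n) + (n + 1) by omega, pow_add] at hx
  rw [Submodule.Quotient.mk_eq_zero, Ideal.mem_span_singleton]
  exact (mul_dvd_mul_iff_left (pow_ne_zero _ PowerSeries.X_ne_zero)).1 hx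

theorem qmodShift_range (n m : ℕ) (hnm : n ≤ m) (y : qmod K (m+1)) :
    (∃ x, qmodShift K n m hnm x = (PowerSeries.X : PowerSeries K) ^ (m - n) • y) := by
  obtain ⟨y, rfl⟩ := Submodule.Quotient.mk_surjective _ y
  exact ⟨Submodule.Quotient.mk y, rfl⟩

theorem qmodShift_eq (n m : ℕ) (hnm : n ≤ m) (x : qmod K (n+1)) :
    (∃ y, qmodShift K n m hnm x = (PowerSeries.X : PowerSeries K) ^ (m - n) • y) := by
  obtain ⟨x, rfl⟩ := Submodule.Quotient.mk_surjective _ x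
  exact ⟨Submodule.Quotient.mk x, rfl⟩

/-- `t^k`-torsion in `R/t^{m+1}` with `k ≤ n+1` is in the range of the shift. -/
theorem qmodShift_torsion (n m k : ℕ) (hnm : n ≤ m) (hk : k ≤ n + 1) (y : qmod K (m+1))
    (hy : (PowerSeries.X : PowerSeries K) ^ k • y = 0) :
    ∃ x, qmodShift K n m hnm x = y ∧ (PowerSeries.X : PowerSeries K) ^ k • x = 0 := by
  have : ∃ x, qmodShift K n m hnm x = y := by
    obtain ⟨y, rfl⟩ := Submodule.Quotient.mk_surjective _ y
    rw [← Submodule.Quotient.mk_smul, Submodule.Quotient.mk_eq_zero, Ideal.mem_span_singleton,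
      show m + 1 = k + (m + 1 - k) by omega, pow_add, smul_eq_mul] at hy
    have h2 := (mul_dvd_mul_iff_left (pow_ne_zero _ PowerSeries.X_ne_zero)).1 hy
    obtain ⟨z, rfl⟩ := (pow_dvd_pow _ (show m - n ≤ m + 1 - k by omega)).trans h2
    exact ⟨Submodule.Quotient.mk z, rfl⟩
  obtain ⟨x, rfl⟩ := this
  exact ⟨x, rfl, qmodShift_inj n m hnm _ (by rw [map_smul, hy])⟩

section
variable (e : ComplexIso C (stdComplex K b c a))

/-- the projection from `H_i` to `⊕ R/t^{a_{i,j}}` -/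
def py (N i : ℕ) (h : ∀ j, a i j ≤ N) :
    homology (tensorQ K C N) i →ₗ[PowerSeries K] (∀ j : Fin (c i), qmod K (a i j)) :=
  Submodule.liftQ _ ((LinearMap.pi fun j => qproj K N (a i j) (h j) ∘ₗ LinearMap.proj j ∘ₗ
      LinearMap.fst _ _ _ ∘ₗ LinearMap.snd _ _ _ ∘ₗ (gX e N i).toLinearMap) ∘ₗ
      (cycles (tensorQ K C N) i).subtype) (by
    intro x hx
    have := (mem_boundaries e N i _).1 hx
    funext j
    exact (qproj_eq_zero _ _ (h j) _).2 (this.2.1 j))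

/-- the projection from `H_i` to `(R/t^k)^b` -/
def px (N i k : ℕ) (h : k ≤ N) :
    homology (tensorQ K C N) i →ₗ[PowerSeries K] (Fin (b i) → qmod K k) :=
  Submodule.liftQ _ ((LinearMap.pi fun j => qproj K N k h ∘ₗ LinearMap.proj j ∘ₗ
      LinearMap.fst _ _ _ ∘ₗ (gX e N i).toLinearMap) ∘ₗ
      (cycles (tensorQ K C N) i).subtype) (by
    intro x hx
    have := (mem_boundaries e N i _).1 hx
    funext j
    change qproj K N k h ((gX e N i x).1 j) = 0
    have h1 : (gX e N i x).1 = 0 := this.1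
    rw [h1]
    exact map_zero _)

theorem mk_eq_zero_iff' (N i : ℕ) (x : cycles (tensorQ K C N) i) :
    (Submodule.Quotient.mk x : homology (tensorQ K C N) i) = 0 ↔ (gX e N i x).1 = 0 ∧
      (∀ j, ∃ y, (gX e N i x).2.1 j = (PowerSeries.X : PowerSeries K) ^ a i j • y) ∧
      (gX e N i x).2.2 = 0 := by
  rw [Submodule.Quotient.mk_eq_zero]
  exact mem_boundaries e N i _

theorem map_mk (n m : ℕ) (hnm : n ≤ m) (i : ℕ) (x : cycles (tensorQ K C (n+1)) i) :
    (tensorShift K C n m hnm).homologyMap i (Submodule.Quotient.mk x) =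
      Submodule.Quotient.mk ⟨(tensorShift K C n m hnm).f i x, mapsTo_cycles _ i _ x.2⟩ := rfl

/-- build a cycle from coordinates -/
def mkc (N i : ℕ) (v : mX K b c N i)
    (hv : ∀ j, (PowerSeries.X : PowerSeries K) ^ prevA a i j • v.2.2 j = 0) :
    cycles (tensorQ K C N) i :=
  ⟨(gX e N i).symm v, (mem_cycles e N i _).2 (by rwa [LinearEquiv.apply_symm_apply])⟩

theorem gX_mkc (N i : ℕ) (v : mX K b c N i) (hv) : gX e N i (mkc e N i v hv) = v :=
  LinearEquiv.apply_symm_apply _ _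

theorem map_mk_eq_zero (e : ComplexIso C (stdComplex K b c a)) (n m : ℕ) (hnm : n ≤ m) (i : ℕ) (x : cycles (tensorQ K C (n+1)) i) :
    (tensorShift K C n m hnm).homologyMap i (Submodule.Quotient.mk x) = 0 ↔
     (∀ j, qmodShift K n m hnm ((gX e (n+1) i x).1 j) = 0) ∧
     (∀ j, ∃ y, qmodShift K n m hnm ((gX e (n+1) i x).2.1 j) =
        (PowerSeries.X : PowerSeries K) ^ a i j • y) ∧
     (∀ j, qmodShift K n m hnm ((gX e (n+1) i x).2.2 j) = 0) := by
  rw [map_mk, mk_eq_zero_iff' e]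
  dsimp only
  rw [gX_shift, funext_iff, funext_iff]
  rfl

theorem ker_equiv (e : ComplexIso C (stdComplex K b c a)) (n m : ℕ) (hnm : n ≤ m) (i : ℕ)
    (hbound₁ : ∀ j : Fin (c i), a i j ≤ n + 1)
    (hbound₂ : ∀ j : Fin (c i), a i j ≤ m - n) :
    Nonempty
      (LinearMap.ker ((tensorShift K C n m hnm).homologyMap i) ≃ₗ[PowerSeries K]
        (∀ j : Fin (c i), qmod K (a i j))) := by
  refine ⟨LinearEquiv.ofBijective (py e (n+1) i hbound₁ ∘ₗ Submodule.subtype _) ⟨?_, ?_⟩⟩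
  · rw [injective_iff_map_eq_zero]
    rintro ⟨x, hx⟩ h
    obtain ⟨x, rfl⟩ := Submodule.Quotient.mk_surjective _ x
    rw [LinearMap.mem_ker, map_mk_eq_zero e] at hx
    apply Subtype.ext
    refine (mk_eq_zero_iff' e _ _ _).2 ⟨?_, ?_, ?_⟩
    · funext j; exact qmodShift_inj _ _ _ _ (hx.1 j)
    · intro j; exact (qproj_eq_zero _ _ (hbound₁ j) _).1 (congrFun h j)
    · funext j; exact qmodShift_inj _ _ _ _ (hx.2.2 j)
  · intro y
    choose z hz using fun j => qproj_surj (n+1) (a i j) (hbound₁ j) (y j)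
    have hv : ∀ j, (PowerSeries.X : PowerSeries K) ^ prevA a i j •
        ((0, z, 0) : mX K b c (n+1) i).2.2 j = 0 := fun j => smul_zero _
    refine ⟨⟨Submodule.Quotient.mk (mkc e (n+1) i (0, z, 0) hv), ?_⟩, ?_⟩
    · rw [LinearMap.mem_ker, map_mk_eq_zero e, gX_mkc]
      refine ⟨fun j => map_zero _, fun j => ?_, fun j => map_zero _⟩
      obtain ⟨w, hw⟩ := qmodShift_eq n m hnm (z j)
      refine ⟨(PowerSeries.X : PowerSeries K) ^ (m - n - a i j) • w, ?_⟩
      rw [smul_smul, ← pow_add, Nat.add_sub_cancel' (hbound₂ j)]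
      exact hw
    · funext j
      change qproj K _ _ (hbound₁ j) ((gX e (n+1) i (mkc e (n+1) i (0, z, 0) hv)).2.1 j) = _
      rw [gX_mkc]
      exact hz j

theorem coker_equiv (e : ComplexIso C (stdComplex K b c a)) (n m : ℕ) (hnm : n ≤ m) (i : ℕ)
    (hbound₁ : ∀ j : Fin (c i), a i j ≤ n + 1)
    (hbound₂ : ∀ j : Fin (c i), a i j ≤ m - n)
    (hbound₃ : ∀ j : Fin (prevNat c i), prevA a i j ≤ n + 1) :
    Nonempty
      ((homology (tensorQ K C (m + 1)) i ⧸
          LinearMap.range ((tensorShift K C n m hnm).homologyMap i))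
        ≃ₗ[PowerSeries K]
        ((Fin (b i) → qmod K (m - n)) × ∀ j : Fin (c i), qmod K (a i j))) := by
  have ha : ∀ j : Fin (c i), a i j ≤ m + 1 := fun j => (hbound₁ j).trans (by omega)
  have hmn : m - n ≤ m + 1 := by omega
  let p := (px e (m+1) i (m-n) hmn).prod (py e (m+1) i ha)
  have hs : Function.Surjective p := by
    rintro ⟨x, y⟩
    choose w hw using fun j => qproj_surj (m+1) (m-n) hmn (x j)
    choose z hz using fun j => qproj_surj (m+1) (a i j) (ha j) (y j)
    have hv : ∀ j, (PowerSeries.X : PowerSeries K) ^ prevA a i j •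
        ((w, z, 0) : mX K b c (m+1) i).2.2 j = 0 := fun j => smul_zero _
    refine ⟨Submodule.Quotient.mk (mkc e (m+1) i (w, z, 0) hv), Prod.ext ?_ ?_⟩
    · funext j
      change qproj K _ _ hmn ((gX e (m+1) i (mkc e (m+1) i (w, z, 0) hv)).1 j) = _
      rw [gX_mkc]
      exact hw j
    · funext j
      change qproj K _ _ (ha j) ((gX e (m+1) i (mkc e (m+1) i (w, z, 0) hv)).2.1 j) = _
      rw [gX_mkc]
      exact hz j
  have hk : LinearMap.range ((tensorShift K C n m hnm).homologyMap i) = LinearMap.ker p := by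
    apply le_antisymm
    · rintro _ ⟨x, rfl⟩
      obtain ⟨x, rfl⟩ := Submodule.Quotient.mk_surjective _ x
      rw [LinearMap.mem_ker, map_mk]
      refine Prod.ext ?_ ?_
      · funext j
        change qproj K _ _ hmn ((gX e (m+1) i ((tensorShift K C n m hnm).f i x)).1 j) = 0
        rw [gX_shift, qproj_eq_zero]
        exact qmodShift_eq _ _ _ _
      · funext j
        change qproj K _ _ (ha j) ((gX e (m+1) i ((tensorShift K C n m hnm).f i x)).2.1 j) = 0
        rw [gX_shift, qproj_eq_zero]
        obtain ⟨w, hw⟩ := qmodShift_eq n m hnm ((gX e (n+1) i x).2.1 j)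
        refine ⟨(PowerSeries.X : PowerSeries K) ^ (m - n - a i j) • w, ?_⟩
        rw [smul_smul, ← pow_add, Nat.add_sub_cancel' (hbound₂ j)]
        exact hw
    · intro x hx
      obtain ⟨x, rfl⟩ := Submodule.Quotient.mk_surjective _ x
      have h1 : ∀ j, ∃ y, (gX e (m+1) i x).1 j = (PowerSeries.X : PowerSeries K) ^ (m-n) • y :=
        fun j => (qproj_eq_zero _ _ hmn _).1 (congrFun (congrArg Prod.fst hx) j)
      have h2 : ∀ j, ∃ y, (gX e (m+1) i x).2.1 j = (PowerSeries.X : PowerSeries K) ^ a i j • y :=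
        fun j => (qproj_eq_zero _ _ (ha j) _).1 (congrFun (congrArg Prod.snd hx) j)
      have h3 := (mem_cycles e (m+1) i x).1 x.2
      choose y hy using h1
      choose w hw using fun j => qmodShift_range n m hnm (y j)
      choose z hz hz' using fun j => qmodShift_torsion n m _ hnm (hbound₃ j) _ (h3 j)
      refine ⟨Submodule.Quotient.mk (mkc e (n+1) i (w, 0, z) hz'), ?_⟩
      rw [map_mk, ← sub_eq_zero, ← Submodule.Quotient.mk_sub, ← neg_eq_zero,
        ← Submodule.Quotient.mk_neg, neg_sub, mk_eq_zero_iff' e]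
      have : gX e (m+1) i (x - ⟨(tensorShift K C n m hnm).f i (mkc e (n+1) i (w, 0, z) hz'),
          mapsTo_cycles _ i _ (mkc e (n+1) i (w, 0, z) hz').2⟩ : cycles (tensorQ K C (m+1)) i)
          = (0, (gX e (m+1) i x).2.1, 0) := by
        rw [Submodule.coe_sub, map_sub, gX_shift, gX_mkc]
        refine Prod.ext ?_ (Prod.ext ?_ ?_)
        · funext j
          exact sub_eq_zero.2 ((hy j).trans (hw j).symm)
        · funext j
          change _ - qmodShift K n m hnm 0 = _
          rw [map_zero, sub_zero]
        · funext j
          exact sub_eq_zero.2 (hz j).symm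
      rw [this]
      exact ⟨rfl, h2, rfl⟩
  exact ⟨(Submodule.quotEquivOfEq _ _ hk).trans (p.quotKerEquivOfSurjective hs)⟩

end
end
end TorsionComplex
end

/-- Let `K` be a field, `R = K⟦t⟧`, and let `C` be a chain complex of
finitely generated free `R`-modules isomorphic to
`(⊕_i F(i)^{b_i}) ⊕ (⊕_i ⊕_{j<c_i} E(i, a_{i,j}))` with all `a_{i,j} ≥ 1`. For `m ≥ n`
let `ψ_{n,m} : C ⊗_R R/(t^{n+1}) → C ⊗_R R/(t^{m+1})` be induced by
`x ↦ t^{m−n}·x`. If `a_{i,j} ≤ n+1` and `a_{i,j} ≤ m−n` for all `j < c_i`, and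
`a_{i−1,j} ≤ n+1` for all `j < c_{i−1}`, then
`ker H_i(ψ_{n,m}) ≅ ⊕_j R/(t^{a_{i,j}})`, of `K`-dimension `Σ_j a_{i,j}`, and
`coker H_i(ψ_{n,m}) ≅ (R/(t^{m−n}))^{b_i} ⊕ ⊕_j R/(t^{a_{i,j}})`, of `K`-dimension
`(m−n)·b_i + Σ_j a_{i,j}`. -/
theorem homologyMap_ker_coker (K : Type u) [Field K]
    (C : NatComplex (PowerSeries K)) (b c : ℕ → ℕ) (a : ∀ i, Fin (c i) → ℕ)
    (hpos : ∀ i j, 1 ≤ a i j)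
    (hiso : Nonempty (ComplexIso C (stdComplex K b c a)))
    (n m : ℕ) (hnm : n ≤ m) (i : ℕ)
    (hbound₁ : ∀ j : Fin (c i), a i j ≤ n + 1)
    (hbound₂ : ∀ j : Fin (c i), a i j ≤ m - n)
    (hbound₃ : ∀ j : Fin (prevNat c i), prevA a i j ≤ n + 1) :
    Nonempty
      (LinearMap.ker ((tensorShift K C n m hnm).homologyMap i) ≃ₗ[PowerSeries K]
        (∀ j : Fin (c i), qmod K (a i j))) ∧
    Module.finrank K (RestrictScalars K (PowerSeries K)
        (LinearMap.ker ((tensorShift K C n m hnm).homologyMap i)))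
      = ∑ j : Fin (c i), a i j ∧
    Nonempty
      ((homology (tensorQ K C (m + 1)) i ⧸
          LinearMap.range ((tensorShift K C n m hnm).homologyMap i))
        ≃ₗ[PowerSeries K]
        ((Fin (b i) → qmod K (m - n)) × ∀ j : Fin (c i), qmod K (a i j))) ∧
    Module.finrank K (RestrictScalars K (PowerSeries K)
        (homology (tensorQ K C (m + 1)) i ⧸
          LinearMap.range ((tensorShift K C n m hnm).homologyMap i)))
      = (m - n) * b i + ∑ j : Fin (c i), a i j := by
  obtain ⟨e⟩ := hiso
  have hk := ker_equiv e n m hnm i hbound₁ hbound₂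
  have hc := coker_equiv e n m hnm i hbound₁ hbound₂ hbound₃
  refine ⟨hk, ?_, hc, ?_⟩
  · obtain ⟨f⟩ := hk
    rw [finrank_of_equiv K f, Module.finrank_pi_fintype]
    exact Finset.sum_congr rfl fun j _ => (finrank_qmod K _).1
  · obtain ⟨f⟩ := hc
    rw [finrank_of_equiv K f, Module.finrank_prod, Module.finrank_pi_fintype,
      Module.finrank_pi_fintype]
    simp only [(finrank_qmod K _).1, Finset.sum_const, Finset.card_univ, Fintype.card_fin,
      smul_eq_mul, mul_comm]
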